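/- A normal curve (closed curve meeting each 2-simplex in normal arcs) on the boundary of a tetrahedron has length (number of intersections with the edges of the tetrahedron) equal to 3, 4, or at least 8; in particular no normal curve on the boundary of a tetrahedron has length 5, 6, or 7. -/

import Mathlib

open Set

/-- Continuous choice of an argument for the difference of two disjoint planar paths. -/
lemma nc_exists_angle (α β : ℝ → ℂ) (hα : Continuous α) (hβ : Continuous β)
    (hd : ∀ s ∈ Icc (0:ℝ) 1, ∀ t ∈ Icc (0:ℝ) 1, α s ≠ β t)
    (e₀ : ℂ) (h0 : α 0 - β 0 = Complex.exp e₀) :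
    ∃ (θ r : ℝ × ℝ → ℝ), Continuous θ ∧ θ (0, 0) = e₀.im ∧ (∀ p, 0 < r p) ∧
      ∀ s ∈ Icc (0:ℝ) 1, ∀ t ∈ Icc (0:ℝ) 1,
        (α s - β t).re = r (s, t) * Real.cos (θ (s, t)) ∧
        (α s - β t).im = r (s, t) * Real.sin (θ (s, t)) := by
  let cl : ℝ → ℝ := fun s => max 0 (min 1 s)
  have hcl : Continuous cl := by fun_prop
  have hcm : ∀ s, cl s ∈ Icc (0:ℝ) 1 := fun s => ⟨le_max_left _ _, by simp [cl]⟩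
  have hci : ∀ s ∈ Icc (0:ℝ) 1, cl s = s := fun s hs => by
    simp [cl, min_eq_right hs.2, max_eq_right hs.1]
  let f : C(ℝ × ℝ, ℂ) := ⟨fun p => α (cl p.1) - β (cl p.2), by fun_prop⟩
  have hf0 : f (0, 0) = α 0 - β 0 := by
    simp [f, hci 0 (by simp)]
  obtain ⟨F, ⟨hF0, hF⟩, -⟩ := Complex.isCoveringMapOn_exp.existsUnique_continuousMap_lifts f
    (a₀ := ((0:ℝ), (0:ℝ))) (e₀ := e₀) (by rw [hf0, h0])
    (fun a => by simpa [f, sub_eq_zero] using hd _ (hcm a.1) _ (hcm a.2))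
  refine ⟨fun p => (F p).im, fun p => Real.exp (F p).re, by fun_prop, congrArg Complex.im hF0,
    fun p => Real.exp_pos _, ?_⟩
  intro s hs t ht
  have h := congrFun hF (s, t)
  simp only [Function.comp, f, ContinuousMap.coe_mk, hci s hs, hci t ht] at h
  rw [← h, Complex.exp_re, Complex.exp_im]
  exact ⟨rfl, rfl⟩

/-- An angle that stays in a half plane varies in an interval of length `π`. -/
lemma nc_stay (φ : ℝ → ℝ) (hφ : Continuous φ) (a : ℝ)
    (hs : ∀ t ∈ Icc (0:ℝ) 1, 0 ≤ Real.sin (φ t - a))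
    (h0 : a - Real.pi < φ 0) (h0' : φ 0 < a + 2 * Real.pi) :
    a ≤ φ 1 ∧ φ 1 ≤ a + Real.pi := by
  have hpi := Real.pi_pos
  have hz := hs 0 (by simp)
  replace h0 : a ≤ φ 0 := by
    by_contra hc
    have := Real.sin_neg_of_neg_of_neg_pi_lt (x := φ 0 - a) (by linarith) (by linarith)
    linarith
  replace h0' : φ 0 ≤ a + Real.pi := by
    by_contra hc
    have := Real.sin_neg_of_neg_of_neg_pi_lt (x := φ 0 - a - 2 * Real.pi)
      (by linarith) (by linarith)
    rw [Real.sin_sub_two_pi] at this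
    linarith
  have k1 : a - Real.pi / 2 < φ 1 := by
    by_contra hc
    obtain ⟨t, ht, he⟩ := intermediate_value_Icc' (zero_le_one) hφ.continuousOn
      (show a - Real.pi / 2 ∈ Icc (φ 1) (φ 0) from ⟨not_lt.1 hc, by linarith⟩)
    have := hs t ht
    rw [he, show a - Real.pi / 2 - a = -(Real.pi / 2) by ring, Real.sin_neg,
      Real.sin_pi_div_two] at this
    linarith
  have k2 : φ 1 < a + 3 * Real.pi / 2 := by
    by_contra hc
    obtain ⟨t, ht, he⟩ := intermediate_value_Icc (zero_le_one) hφ.continuousOn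
      (show a + 3 * Real.pi / 2 ∈ Icc (φ 0) (φ 1) from ⟨by linarith, not_lt.1 hc⟩)
    have := hs t ht
    rw [he, show a + 3 * Real.pi / 2 - a = Real.pi / 2 + Real.pi by ring, Real.sin_add_pi,
      Real.sin_pi_div_two] at this
    linarith
  have h1 := hs 1 (by simp)
  constructor
  · by_contra hc
    have := Real.sin_neg_of_neg_of_neg_pi_lt (x := φ 1 - a) (by linarith) (by linarith)
    linarith
  · by_contra hc
    have := Real.sin_neg_of_neg_of_neg_pi_lt (x := φ 1 - a - 2 * Real.pi)
      (by linarith) (by linarith)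
    rw [Real.sin_sub_two_pi] at this
    linarith

lemma nc_nonneg_of_mul {r x y : ℝ} (hr : 0 < r) (h : y = r * x) (hy : 0 ≤ y) : 0 ≤ x := by
  rw [h] at hy
  exact nonneg_of_mul_nonneg_right hy hr

/-- Crossing lemma, first form. -/
lemma nc_cross1 (α β : ℝ → ℂ) (hα : Continuous α) (hβ : Continuous β)
    (hd : ∀ s ∈ Icc (0:ℝ) 1, ∀ t ∈ Icc (0:ℝ) 1, α s ≠ β t)
    (hα0 : ∀ s ∈ Icc (0:ℝ) 1, 0 ≤ (α s).re ∧ 0 ≤ (α s).im ∧ (α s).re + (α s).im ≤ 1)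
    (hβ0 : ∀ s ∈ Icc (0:ℝ) 1, 0 ≤ (β s).re ∧ 0 ≤ (β s).im ∧ (β s).re + (β s).im ≤ 1)
    (h1 : (α 0).re = 0) (h2 : (β 0).re = 0) (h3 : (α 1).im = 0)
    (h4 : (β 1).re + (β 1).im = 1) : (α 0).im < (β 0).im := by
  have m0 : (0:ℝ) ∈ Icc (0:ℝ) 1 := by simp
  have m1 : (1:ℝ) ∈ Icc (0:ℝ) 1 := by simp
  have hpi := Real.pi_pos
  by_contra hc
  have hne : (α 0).im ≠ (β 0).im := fun h => hd 0 m0 0 m0 (Complex.ext (by rw [h1, h2]) h)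
  have hpos : 0 < (α 0).im - (β 0).im := by
    have := lt_of_le_of_ne (not_lt.1 hc) hne.symm
    linarith
  obtain ⟨θ, r, hθ, hθ0, hr, hrs⟩ := nc_exists_angle α β hα hβ hd
    ⟨Real.log ((α 0).im - (β 0).im), Real.pi / 2⟩ (by
      apply Complex.ext
      · rw [Complex.exp_re]; simp [h1, h2]
      · rw [Complex.exp_im]; simp [Real.exp_log hpos])
  change θ (0, 0) = _ at hθ0
  dsimp only at hθ0
  have a1 := nc_stay (fun t => θ (0, t)) (by fun_prop) (Real.pi / 2) (fun t ht => by
    obtain ⟨e1, e2⟩ := hrs 0 m0 t ht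
    rw [Real.sin_sub_pi_div_two]
    refine nc_nonneg_of_mul (hr (0, t)) (y := -(α 0 - β t).re) (by rw [e1]; ring) ?_
    have := hβ0 t ht
    simp only [Complex.sub_re]; linarith) (by linarith) (by linarith)
  have a2 := nc_stay (fun t => θ (t, 0)) (by fun_prop) (-(Real.pi / 2)) (fun t ht => by
    obtain ⟨e1, e2⟩ := hrs t ht 0 m0
    rw [sub_neg_eq_add, Real.sin_add_pi_div_two]
    refine nc_nonneg_of_mul (hr (t, 0)) (y := (α t - β 0).re) (by rw [e1]) ?_
    have := hα0 t ht
    simp only [Complex.sub_re]; linarith) (by linarith) (by linarith)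
  have a3 := nc_stay (fun t => θ (1, t)) (by fun_prop) (-Real.pi) (fun t ht => by
    obtain ⟨e1, e2⟩ := hrs 1 m1 t ht
    rw [sub_neg_eq_add, Real.sin_add_pi]
    refine nc_nonneg_of_mul (hr (1, t)) (y := -(α 1 - β t).im) (by rw [e2]; ring) ?_
    have := hβ0 t ht
    simp only [Complex.sub_im]; linarith) (by linarith) (by linarith)
  have a4 := nc_stay (fun t => θ (t, 1)) (by fun_prop) (3 * Real.pi / 4) (fun t ht => by
    obtain ⟨e1, e2⟩ := hrs t ht 1 m1
    rw [show θ (t, 1) - 3 * Real.pi / 4 = θ (t, 1) + Real.pi / 4 - Real.pi by ring,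
      Real.sin_sub_pi, Real.sin_add, Real.cos_pi_div_four, Real.sin_pi_div_four]
    refine nc_nonneg_of_mul (hr (t, 1))
      (y := (√2 / 2) * (-(α t - β 1).re - (α t - β 1).im)) (by rw [e1, e2]; ring) ?_
    have := hα0 t ht
    refine mul_nonneg (by positivity) ?_
    simp only [Complex.sub_re, Complex.sub_im]; linarith) (by linarith) (by linarith)
  linarith

/-- Crossing lemma, second form. -/
lemma nc_cross2 (α β : ℝ → ℂ) (hα : Continuous α) (hβ : Continuous β)
    (hd : ∀ s ∈ Icc (0:ℝ) 1, ∀ t ∈ Icc (0:ℝ) 1, α s ≠ β t)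
    (hα0 : ∀ s ∈ Icc (0:ℝ) 1, 0 ≤ (α s).re ∧ 0 ≤ (α s).im)
    (hβ0 : ∀ s ∈ Icc (0:ℝ) 1, 0 ≤ (β s).re ∧ 0 ≤ (β s).im)
    (h1 : (α 0).re = 0) (h2 : (β 0).re = 0) (h3 : (α 1).im = 0) (h4 : (β 1).im = 0)
    (hlt : (α 0).im < (β 0).im) : (α 1).re < (β 1).re := by
  have m0 : (0:ℝ) ∈ Icc (0:ℝ) 1 := by simp
  have m1 : (1:ℝ) ∈ Icc (0:ℝ) 1 := by simp
  have hpi := Real.pi_pos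
  by_contra hc
  have hne : (α 1).re ≠ (β 1).re := fun h => hd 1 m1 1 m1 (Complex.ext h (by rw [h3, h4]))
  have hpos : 0 < (α 1).re - (β 1).re := by
    have := lt_of_le_of_ne (not_lt.1 hc) hne.symm
    linarith
  have hpos' : 0 < (β 0).im - (α 0).im := by linarith
  obtain ⟨θ, r, hθ, hθ0, hr, hrs⟩ := nc_exists_angle α β hα hβ hd
    ⟨Real.log ((β 0).im - (α 0).im), -(Real.pi / 2)⟩ (by
      apply Complex.ext
      · rw [Complex.exp_re]; simp [h1, h2]
      · rw [Complex.exp_im]; simp [Real.exp_log hpos'])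
  change θ (0, 0) = _ at hθ0
  dsimp only at hθ0
  have a1 := nc_stay (fun t => θ (0, t)) (by fun_prop) (-(3 * Real.pi / 2)) (fun t ht => by
    obtain ⟨e1, e2⟩ := hrs 0 m0 t ht
    rw [show θ (0, t) - -(3 * Real.pi / 2) = θ (0, t) + Real.pi / 2 + Real.pi by ring,
      Real.sin_add_pi, Real.sin_add_pi_div_two]
    refine nc_nonneg_of_mul (hr (0, t)) (y := -(α 0 - β t).re) (by rw [e1]; ring) ?_
    have := hβ0 t ht
    simp only [Complex.sub_re]; linarith) (by linarith) (by linarith)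
  have a2 := nc_stay (fun t => θ (t, 0)) (by fun_prop) (-(Real.pi / 2)) (fun t ht => by
    obtain ⟨e1, e2⟩ := hrs t ht 0 m0
    rw [sub_neg_eq_add, Real.sin_add_pi_div_two]
    refine nc_nonneg_of_mul (hr (t, 0)) (y := (α t - β 0).re) (by rw [e1]) ?_
    have := hα0 t ht
    simp only [Complex.sub_re]; linarith) (by linarith) (by linarith)
  have a3 := nc_stay (fun t => θ (1, t)) (by fun_prop) (-Real.pi) (fun t ht => by
    obtain ⟨e1, e2⟩ := hrs 1 m1 t ht
    rw [sub_neg_eq_add, Real.sin_add_pi]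
    refine nc_nonneg_of_mul (hr (1, t)) (y := -(α 1 - β t).im) (by rw [e2]; ring) ?_
    have := hβ0 t ht
    simp only [Complex.sub_im]; linarith) (by linarith) (by linarith)
  have a4 := nc_stay (fun t => θ (t, 1)) (by fun_prop) (-(2 * Real.pi)) (fun t ht => by
    obtain ⟨e1, e2⟩ := hrs t ht 1 m1
    rw [sub_neg_eq_add, Real.sin_add_two_pi]
    refine nc_nonneg_of_mul (hr (t, 1)) (y := (α t - β 1).im) (by rw [e2]) ?_
    have := hα0 t ht
    simp only [Complex.sub_im]; linarith) (by linarith) (by linarith)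
  have he : θ (1, 1) = -Real.pi := by linarith
  obtain ⟨e1, e2⟩ := hrs 1 m1 1 m1
  rw [he, Real.cos_neg, Real.cos_pi, Complex.sub_re] at e1
  have := hr (1, 1)
  linarith

lemma nc_univ (i j k l m : Fin 4) (hij : i ≠ j) (hik : i ≠ k) (hil : i ≠ l) (hjk : j ≠ k)
    (hjl : j ≠ l) (hkl : k ≠ l) : m = i ∨ m = j ∨ m = k ∨ m = l := by
  omega

lemma nc_sum (x : Fin 4 → ℝ) (hx : x ∈ stdSimplex ℝ (Fin 4)) (i j k l : Fin 4)
    (hij : i ≠ j) (hik : i ≠ k) (hil : i ≠ l) (hjk : j ≠ k)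
    (hjl : j ≠ l) (hkl : k ≠ l) : x i + x j + x k + x l = 1 := by
  have h : (Finset.univ : Finset (Fin 4)) = {i, j, k, l} := by
    ext m
    simpa using nc_univ i j k l m hij hik hil hjk hjl hkl
  rw [← hx.2, h, Finset.sum_insert (by simp [*]), Finset.sum_insert (by simp [*]),
    Finset.sum_insert (by simp [*]), Finset.sum_singleton]
  ring

lemma nc_ext {x y : Fin 4 → ℝ} (hx : x ∈ stdSimplex ℝ (Fin 4)) (hy : y ∈ stdSimplex ℝ (Fin 4))
    (i j k l : Fin 4) (hij : i ≠ j) (hik : i ≠ k) (hil : i ≠ l) (hjk : j ≠ k)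
    (hjl : j ≠ l) (hkl : k ≠ l) (h1 : x i = y i) (h2 : x j = y j) (h3 : x k = y k) : x = y := by
  have e1 := nc_sum x hx i j k l hij hik hil hjk hjl hkl
  have e2 := nc_sum y hy i j k l hij hik hil hjk hjl hkl
  ext m
  rcases nc_univ i j k l m hij hik hil hjk hjl hkl with h | h | h | h <;> subst h
  · exact h1
  · exact h2
  · exact h3
  · linarith

lemma nc_mem_uIcc (a b s : ℝ) (hs : s ∈ Icc (0:ℝ) 1) : a + s * (b - a) ∈ uIcc a b := by
  rw [mem_uIcc]
  rcases le_total a b with h | h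
  · left; constructor <;> nlinarith [hs.1, hs.2]
  · right; constructor <;> nlinarith [hs.1, hs.2]

/-- Two disjoint arcs in a face, starting on the same edge and ending on different edges. -/
lemma nc_X1 (c : ℝ → Fin 4 → ℝ) (hc : Continuous c) (hm : ∀ t, c t ∈ stdSimplex ℝ (Fin 4))
    (i j k l : Fin 4) (hij : i ≠ j) (hik : i ≠ k) (hil : i ≠ l) (hjk : j ≠ k)
    (hjl : j ≠ l) (hkl : k ≠ l) (a b a' b' : ℝ)
    (h1 : ∀ t ∈ uIcc a b, c t i = 0) (h2 : ∀ t ∈ uIcc a' b', c t i = 0)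
    (hd : ∀ s ∈ uIcc a b, ∀ t ∈ uIcc a' b', c s ≠ c t)
    (ha : c a j = 0) (ha' : c a' j = 0) (hb : c b k = 0) (hb' : c b' l = 0) :
    c a' l < c a l := by
  have hcc : ∀ m, Continuous fun t => c t m := fun m => (continuous_apply m).comp hc
  have hsum := fun t => nc_sum (c t) (hm t) i j k l hij hik hil hjk hjl hkl
  have key := nc_cross1 (fun s => (c (a + s * (b - a)) j : ℂ) + c (a + s * (b - a)) k * Complex.I)
    (fun s => (c (a' + s * (b' - a')) j : ℂ) + c (a' + s * (b' - a')) k * Complex.I)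
    (by have := hcc j; have := hcc k; fun_prop) (by have := hcc j; have := hcc k; fun_prop)
    (fun s hs t ht he => by
      have e1 := congrArg Complex.re he
      have e2 := congrArg Complex.im he
      simp at e1 e2
      have ms := nc_mem_uIcc a b s hs
      have mt := nc_mem_uIcc a' b' t ht
      exact hd _ ms _ mt (nc_ext (hm _) (hm _) i j k l hij hik hil hjk hjl hkl
        (by rw [h1 _ ms, h2 _ mt]) e1 e2))
    (fun s hs => by
      have ms := nc_mem_uIcc a b s hs
      have := hsum (a + s * (b - a))
      have := h1 _ ms
      have := (hm (a + s * (b - a))).1 l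
      simp
      exact ⟨(hm _).1 j, (hm _).1 k, by linarith⟩)
    (fun s hs => by
      have ms := nc_mem_uIcc a' b' s hs
      have := hsum (a' + s * (b' - a'))
      have := h2 _ ms
      have := (hm (a' + s * (b' - a'))).1 l
      simp
      exact ⟨(hm _).1 j, (hm _).1 k, by linarith⟩)
    (by simpa using ha) (by simpa using ha') (by simpa using hb)
    (by
      have := hsum b'
      have := h2 b' right_mem_uIcc
      simp
      linarith)
  simp at key
  have := hsum a
  have := hsum a'
  have := h1 a left_mem_uIcc
  have := h2 a' left_mem_uIcc
  linarith

/-- Two disjoint arcs in a face, starting on the same edge and ending on the same edge. -/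
lemma nc_X2 (c : ℝ → Fin 4 → ℝ) (hc : Continuous c) (hm : ∀ t, c t ∈ stdSimplex ℝ (Fin 4))
    (i j k l : Fin 4) (hij : i ≠ j) (hik : i ≠ k) (hil : i ≠ l) (hjk : j ≠ k)
    (hjl : j ≠ l) (hkl : k ≠ l) (a b a' b' : ℝ)
    (h1 : ∀ t ∈ uIcc a b, c t i = 0) (h2 : ∀ t ∈ uIcc a' b', c t i = 0)
    (hd : ∀ s ∈ uIcc a b, ∀ t ∈ uIcc a' b', c s ≠ c t)
    (ha : c a j = 0) (ha' : c a' j = 0) (hb : c b k = 0) (hb' : c b' k = 0)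
    (hlt : c a' l < c a l) : c b' l < c b l := by
  have hcc : ∀ m, Continuous fun t => c t m := fun m => (continuous_apply m).comp hc
  have hsum := fun t => nc_sum (c t) (hm t) i j k l hij hik hil hjk hjl hkl
  have q1 := hsum a
  have q2 := hsum a'
  have q3 := h1 a left_mem_uIcc
  have q4 := h2 a' left_mem_uIcc
  have key := nc_cross2 (fun s => (c (a + s * (b - a)) j : ℂ) + c (a + s * (b - a)) k * Complex.I)
    (fun s => (c (a' + s * (b' - a')) j : ℂ) + c (a' + s * (b' - a')) k * Complex.I)
    (by have := hcc j; have := hcc k; fun_prop) (by have := hcc j; have := hcc k; fun_prop)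
    (fun s hs t ht he => by
      have e1 := congrArg Complex.re he
      have e2 := congrArg Complex.im he
      simp at e1 e2
      have ms := nc_mem_uIcc a b s hs
      have mt := nc_mem_uIcc a' b' t ht
      exact hd _ ms _ mt (nc_ext (hm _) (hm _) i j k l hij hik hil hjk hjl hkl
        (by rw [h1 _ ms, h2 _ mt]) e1 e2))
    (fun s hs => by
      simp
      exact ⟨(hm _).1 j, (hm _).1 k⟩)
    (fun s hs => by
      simp
      exact ⟨(hm _).1 j, (hm _).1 k⟩)
    (by simpa using ha) (by simpa using ha') (by simpa using hb) (by simpa using hb')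
    (by simp; linarith)
  simp at key
  have := hsum b
  have := hsum b'
  have := h1 b right_mem_uIcc
  have := h2 b' right_mem_uIcc
  linarith

/-- The combinatorial description of a normal curve with `n` intersection points:
`T k` are the (cyclically enumerated) intersection times, `F k` the face containing the arc
between `T k` and `T (k+1)`. -/
structure NCData (n : ℕ) (c : ℝ → Fin 4 → ℝ) (T : ℕ → ℝ) (F : ℕ → Fin 4) : Prop where
  cont : Continuous c
  mem : ∀ t, c t ∈ stdSimplex ℝ (Fin 4)
  inj : ∀ s t, s < t → t < s + 1 → c s ≠ c t
  mono : StrictMono T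
  perT : ∀ k, T (k + n) = T k + 1
  perF : ∀ k, F (k + n) = F k
  perc : ∀ t, c (t + 1) = c t
  face : ∀ k, ∀ t ∈ Icc (T k) (T (k + 1)), c t (F k) = 0
  ne1 : ∀ k, F k ≠ F (k + 1)
  ne2 : ∀ k, F k ≠ F (k + 2)

namespace NCData

variable {n : ℕ} {c : ℝ → Fin 4 → ℝ} {T : ℕ → ℝ} {F : ℕ → Fin 4}

lemma shift (D : NCData n c T F) (m : ℕ) :
    NCData n c (fun k => T (k + m)) (fun k => F (k + m)) where
  cont := D.cont
  mem := D.mem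
  inj := D.inj
  mono := fun a b h => D.mono (by omega)
  perT := fun k => by rw [← D.perT (k + m)]; congr 1; omega
  perF := fun k => by rw [← D.perF (k + m)]; congr 1; omega
  perc := D.perc
  face := fun k t ht => D.face (k + m) t (by
    rwa [show k + m + 1 = k + 1 + m by omega])
  ne1 := fun k => by have := D.ne1 (k + m); rwa [show k + m + 1 = k + 1 + m by omega] at this
  ne2 := fun k => by have := D.ne2 (k + m); rwa [show k + m + 2 = k + 2 + m by omega] at this

lemma disj (D : NCData n c T F) {k l : ℕ} (h1 : k + 1 < l) (h2 : l + 1 < k + n) :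
    ∀ s ∈ Icc (T k) (T (k + 1)), ∀ t ∈ Icc (T l) (T (l + 1)), c s ≠ c t := by
  intro s hs t ht
  have a1 := D.mono h1
  have a2 := D.mono h2
  rw [D.perT] at a2
  exact D.inj s t (by linarith [hs.2, ht.1]) (by linarith [hs.1, ht.2])

lemma iccu (D : NCData n c T F) (k : ℕ) : uIcc (T k) (T (k + 1)) = Icc (T k) (T (k + 1)) :=
  uIcc_of_le (D.mono (Nat.lt_succ_self k)).le

lemma iccu' (D : NCData n c T F) (k : ℕ) : uIcc (T (k + 1)) (T k) = Icc (T k) (T (k + 1)) := by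
  rw [uIcc_comm, D.iccu]

lemma left (D : NCData n c T F) (k : ℕ) : c (T k) (F k) = 0 :=
  D.face k _ ⟨le_rfl, (D.mono (Nat.lt_succ_self k)).le⟩

lemma right (D : NCData n c T F) (k : ℕ) : c (T (k + 1)) (F k) = 0 :=
  D.face k _ ⟨(D.mono (Nat.lt_succ_self k)).le, le_rfl⟩

/-- Two arcs in the same face leaving through the same edge, entering through different ones. -/
lemma enter (D : NCData n c T F) {p q : ℕ} (h1 : p + 2 < q)
    (e1 : F (p + 1) = F (q + 1)) (e2 : F (p + 2) = F (q + 2)) (e3 : F p ≠ F q)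
    (h3 : q + 2 < p + 1 + n) :
    c (T (q + 2)) (F q) < c (T (p + 2)) (F q) := by
  have n1 := D.ne1 p
  have n2 := D.ne1 (p + 1)
  have n3 := D.ne2 p
  have n4 := D.ne1 q
  have n6 := D.ne2 q
  refine nc_X1 c D.cont D.mem (F (p + 1)) (F (p + 2)) (F p) (F q) n2 n1.symm
    (by rw [e1]; exact n4.symm) n3.symm (by rw [e2]; exact n6.symm) e3
    (T (p + 2)) (T (p + 1)) (T (q + 2)) (T (q + 1)) ?_ ?_ ?_ ?_ ?_ ?_ ?_
  · rw [D.iccu' (p + 1)]; exact D.face (p + 1)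
  · rw [D.iccu' (q + 1), e1]; exact D.face (q + 1)
  · rw [D.iccu' (p + 1), D.iccu' (q + 1)]; exact D.disj (by omega) (by omega)
  · exact D.left (p + 2)
  · rw [e2]; exact D.left (q + 2)
  · exact D.right p
  · exact D.right q

/-- Two arcs in the same face entering through the same edge, leaving through different ones. -/
lemma leave (D : NCData n c T F) {p q : ℕ} (h1 : p + 2 < q)
    (e1 : F (p + 1) = F (q + 1)) (e2 : F p = F q) (e3 : F (p + 2) ≠ F (q + 2))
    (h3 : q + 2 < p + 1 + n) :
    c (T (q + 1)) (F (q + 2)) < c (T (p + 1)) (F (q + 2)) := by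
  have n1 := D.ne1 p
  have n2 := D.ne1 (p + 1)
  have n3 := D.ne2 p
  have n4 := D.ne1 (q + 1)
  have n6 := D.ne2 q
  refine nc_X1 c D.cont D.mem (F (p + 1)) (F p) (F (p + 2)) (F (q + 2)) n1.symm n2
    (by rw [e1]; exact n4) n3 (by rw [e2]; exact n6) e3
    (T (p + 1)) (T (p + 2)) (T (q + 1)) (T (q + 2)) ?_ ?_ ?_ ?_ ?_ ?_ ?_
  · rw [D.iccu (p + 1)]; exact D.face (p + 1)
  · rw [D.iccu (q + 1), e1]; exact D.face (q + 1)
  · rw [D.iccu (p + 1), D.iccu (q + 1)]; exact D.disj (by omega) (by omega)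
  · exact D.right p
  · rw [e2]; exact D.right q
  · exact D.left (p + 2)
  · exact D.left (q + 2)

/-- Two parallel arcs in the same face. -/
lemma par (D : NCData n c T F) {p q : ℕ} (h1 : p + 2 < q)
    (e0 : F p = F q) (e1 : F (p + 1) = F (q + 1)) (e2 : F (p + 2) = F (q + 2))
    (h3 : q + 2 < p + 1 + n) (l : Fin 4) (l0 : F p ≠ l) (l1 : F (p + 1) ≠ l)
    (l2 : F (p + 2) ≠ l) :
    (c (T (q + 1)) l < c (T (p + 1)) l → c (T (q + 2)) l < c (T (p + 2)) l) ∧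
    (c (T (p + 1)) l < c (T (q + 1)) l → c (T (p + 2)) l < c (T (q + 2)) l) := by
  have n1 := D.ne1 p
  have n2 := D.ne1 (p + 1)
  have n3 := D.ne2 p
  have f1 : ∀ t ∈ uIcc (T (p + 1)) (T (p + 2)), c t (F (p + 1)) = 0 := by
    rw [D.iccu (p + 1)]; exact D.face (p + 1)
  have f2 : ∀ t ∈ uIcc (T (q + 1)) (T (q + 2)), c t (F (p + 1)) = 0 := by
    rw [D.iccu (q + 1), e1]; exact D.face (q + 1)
  have hd : ∀ s ∈ uIcc (T (p + 1)) (T (p + 2)), ∀ t ∈ uIcc (T (q + 1)) (T (q + 2)),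
      c s ≠ c t := by
    rw [D.iccu (p + 1), D.iccu (q + 1)]; exact D.disj (by omega) (by omega)
  have g1 : c (T (q + 1)) (F p) = 0 := by rw [e0]; exact D.right q
  have g2 : c (T (q + 2)) (F (p + 2)) = 0 := by rw [e2]; exact D.left (q + 2)
  exact ⟨nc_X2 c D.cont D.mem (F (p + 1)) (F p) (F (p + 2)) l n1.symm n2 l1 n3 l0 l2
      _ _ _ _ f1 f2 hd (D.right p) g1 (D.left (p + 2)) g2,
    nc_X2 c D.cont D.mem (F (p + 1)) (F p) (F (p + 2)) l n1.symm n2 l1 n3 l0 l2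
      _ _ _ _ f2 f1 (fun s hs t ht => (hd t ht s hs).symm) g1 (D.right p) g2 (D.left (p + 2))⟩

lemma not6a (D : NCData 6 c T F) (h0 : F 0 = F 3) (h1 : F 1 = F 4) (h2 : F 2 = F 5) : False := by
  obtain ⟨l, l0, l1, l2⟩ : ∃ l : Fin 4, F 0 ≠ l ∧ F 1 ≠ l ∧ F 2 ≠ l := by
    generalize F 0 = a
    generalize F 1 = b
    generalize F 2 = d
    revert a b d
    decide
  have h3 : F 3 = F 6 := by rw [← h0]; exact (D.perF 0).symm
  have h4 : F 4 = F 7 := by rw [← h1]; exact (D.perF 1).symm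
  have a1 := D.par (p := 0) (q := 3) (by omega) h0 h1 h2 (by omega) l l0 l1 l2
  have a2 := D.par (p := 1) (q := 4) (by omega) h1 h2 h3 (by omega) l l1 l2 (h0 ▸ l0)
  have a3 := D.par (p := 2) (q := 5) (by omega) h2 h3 h4 (by omega) l l2 (h0 ▸ l0) (h1 ▸ l1)
  norm_num at a1 a2 a3
  have hT : c (T 7) = c (T 1) := by rw [← D.perc (T 1)]; congr 1; exact D.perT 1
  rw [hT] at a3
  have hne : c (T 1) l ≠ c (T 4) l := by
    intro he
    refine D.disj (k := 0) (l := 3) (by omega) (by omega) (T 1)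
      (right_mem_Icc.2 (D.mono (by omega)).le) (T 4)
      (right_mem_Icc.2 (D.mono (by omega)).le) ?_
    have z1 := D.right 0
    have z2 := D.left 1
    have z3 := D.right 3
    have z4 := D.left 4
    rw [← h0] at z3
    rw [← h1] at z4
    exact nc_ext (D.mem _) (D.mem _) (F 0) (F 1) l (F 2) (D.ne1 0) l0 (D.ne2 0) l1 (D.ne1 1)
      l2.symm (z1.trans z3.symm) (z2.trans z4.symm) he
  rcases lt_or_gt_of_ne hne with h | h
  · have := a3.2 (a2.2 (a1.2 h))
    linarith
  · have := a3.1 (a2.1 (a1.1 h))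
    linarith

lemma not6b (D : NCData 6 c T F) (h0 : F 0 = F 3) (h1 : F 1 = F 4) (h2 : F 2 ≠ F 5) : False := by
  have D5 := D.shift 5
  have e6 : F 6 = F 0 := D.perF 0
  have e7 : F 7 = F 1 := D.perF 1
  have e8 : F 8 = F 2 := D.perF 2
  have a2 := D.leave (p := 0) (q := 3) (by omega) h1 h0 h2 (by omega)
  have a1 := D.enter (p := 2) (q := 5) (by omega) (by simpa [e6] using h0.symm)
    (by simpa [e7] using h1.symm) h2 (by omega)
  norm_num at a1 a2
  have hT : c (T 7) = c (T 1) := by rw [← D.perc (T 1)]; congr 1; exact D.perT 1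
  rw [hT] at a1
  linarith

lemma not7 (D : NCData 7 c T F) (h1 : F 1 = F 4) (h2 : F 2 = F 5) (h3 : F 3 = F 6) : False := by
  have e7 : F 7 = F 0 := D.perF 0
  have e8 : F 8 = F 1 := D.perF 1
  have e9 : F 9 = F 2 := D.perF 2
  have n01 : F 0 ≠ F 1 := D.ne1 0
  have n02 : F 0 ≠ F 2 := D.ne2 0
  have n12 : F 1 ≠ F 2 := D.ne1 1
  have n13 : F 1 ≠ F 3 := D.ne2 1
  have n23 : F 2 ≠ F 3 := D.ne1 2
  have n60 : F 6 ≠ F 0 := by rw [← e7]; exact D.ne1 6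
  have n30 : F 3 ≠ F 0 := by rw [h3]; exact n60
  have a1 := D.enter (p := 0) (q := 3) (by omega) h1 h2 n30.symm (by omega)
  have a2 := D.par (p := 1) (q := 4) (by omega) h1 h2 h3 (by omega) (F 0) n01.symm n02.symm n30
  have a3 := D.leave (p := 2) (q := 5) (by omega) h3 h2
    (by norm_num [e7]; rw [← h1]; exact n01.symm) (by omega)
  norm_num [e7] at a1 a2 a3
  have s2 := nc_sum (c (T 2)) (D.mem _) (F 1) (F 2) (F 0) (F 3) n12 n01.symm n13 n02.symm n23
    n30.symm
  have s5 := nc_sum (c (T 5)) (D.mem _) (F 1) (F 2) (F 0) (F 3) n12 n01.symm n13 n02.symm n23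
    n30.symm
  have z1 := D.right 1
  have z2 := D.left 2
  have z3 := D.right 4
  have z4 := D.left 5
  rw [← h1] at z3
  rw [← h2] at z4
  norm_num at z1 z2 z3 z4
  have := a2.2 (by linarith)
  linarith

lemma not5 (D : NCData 5 c T F) : False := by
  have e5 : F 5 = F 0 := D.perF 0
  have e6 : F 6 = F 1 := D.perF 1
  have n1 := D.ne1 0
  have n2 := D.ne1 1
  have n3 := D.ne1 2
  have n4 := D.ne1 3
  have n5 := D.ne1 4
  have m1 := D.ne2 0
  have m2 := D.ne2 1
  have m3 := D.ne2 2
  have m4 := D.ne2 3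
  have m5 := D.ne2 4
  norm_num [e5, e6] at n1 n2 n3 n4 n5 m1 m2 m3 m4 m5
  omega

lemma not6 (D : NCData 6 c T F) : False := by
  have e6 : F 6 = F 0 := D.perF 0
  have e7 : F 7 = F 1 := D.perF 1
  have h : (F 0 = F 3 ∧ F 1 = F 4 ∧ F 2 = F 5) ∨ (F 0 = F 3 ∧ F 1 = F 4 ∧ F 2 ≠ F 5) ∨
      (F 1 = F 4 ∧ F 2 = F 5 ∧ F 3 ≠ F 0) ∨ (F 2 = F 5 ∧ F 3 = F 0 ∧ F 4 ≠ F 1) := by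
    have n1 := D.ne1 0
    have n2 := D.ne1 1
    have n3 := D.ne1 2
    have n4 := D.ne1 3
    have n5 := D.ne1 4
    have n6 := D.ne1 5
    have m1 := D.ne2 0
    have m2 := D.ne2 1
    have m3 := D.ne2 2
    have m4 := D.ne2 3
    have m5 := D.ne2 4
    have m6 := D.ne2 5
    norm_num [e6, e7] at n1 n2 n3 n4 n5 n6 m1 m2 m3 m4 m5 m6
    generalize F 0 = x0 at *
    generalize F 1 = x1 at *
    generalize F 2 = x2 at *
    generalize F 3 = x3 at *
    generalize F 4 = x4 at *
    generalize F 5 = x5 at *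
    clear e6 e7 D
    have key : ∀ x0 x1 : Fin 4, x0 ≠ x1 → ∀ x2, x1 ≠ x2 → x0 ≠ x2 → ∀ x3, x2 ≠ x3 → x1 ≠ x3 →
      ∀ x4, x3 ≠ x4 → x2 ≠ x4 → x4 ≠ x0 → ∀ x5, x4 ≠ x5 → x3 ≠ x5 → x5 ≠ x0 → x5 ≠ x1 →
      ((x0 = x3 ∧ x1 = x4 ∧ x2 = x5) ∨ (x0 = x3 ∧ x1 = x4 ∧ x2 ≠ x5) ∨
      (x1 = x4 ∧ x2 = x5 ∧ x3 ≠ x0) ∨ (x2 = x5 ∧ x3 = x0 ∧ x4 ≠ x1)) := by decide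
    exact key x0 x1 n1 x2 n2 m1 x3 n3 m2 x4 n4 m3 m5 x5 n5 m4 n6 m6
  rcases h with ⟨a, b, d⟩ | ⟨a, b, d⟩ | ⟨a, b, d⟩ | ⟨a, b, d⟩
  · exact D.not6a a b d
  · exact D.not6b a b d
  · exact (D.shift 1).not6b a b (by simpa [e6] using d)
  · exact (D.shift 2).not6b a (by simpa [e6] using b) (by simpa [e7] using d)

set_option synthInstance.maxSize 2000 in
set_option synthInstance.maxHeartbeats 2000000 in
lemma not7' (D : NCData 7 c T F) : False := by
  have e7 : F 7 = F 0 := D.perF 0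
  have e8 : F 8 = F 1 := D.perF 1
  have e9 : F 9 = F 2 := D.perF 2
  have e10 : F 10 = F 3 := D.perF 3
  have e11 : F 11 = F 4 := D.perF 4
  have e12 : F 12 = F 5 := D.perF 5
  have h : (F 1 = F 4 ∧ F 2 = F 5 ∧ F 3 = F 6) ∨ (F 2 = F 5 ∧ F 3 = F 6 ∧ F 4 = F 0) ∨
      (F 3 = F 6 ∧ F 4 = F 0 ∧ F 5 = F 1) ∨ (F 4 = F 0 ∧ F 5 = F 1 ∧ F 6 = F 2) ∨
      (F 5 = F 1 ∧ F 6 = F 2 ∧ F 0 = F 3) ∨ (F 6 = F 2 ∧ F 0 = F 3 ∧ F 1 = F 4) ∨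
      (F 0 = F 3 ∧ F 1 = F 4 ∧ F 2 = F 5) := by
    have n1 := D.ne1 0
    have n2 := D.ne1 1
    have n3 := D.ne1 2
    have n4 := D.ne1 3
    have n5 := D.ne1 4
    have n6 := D.ne1 5
    have n7 := D.ne1 6
    have m1 := D.ne2 0
    have m2 := D.ne2 1
    have m3 := D.ne2 2
    have m4 := D.ne2 3
    have m5 := D.ne2 4
    have m6 := D.ne2 5
    have m7 := D.ne2 6
    norm_num [e7, e8] at n1 n2 n3 n4 n5 n6 n7 m1 m2 m3 m4 m5 m6 m7
    generalize F 0 = x0 at *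
    generalize F 1 = x1 at *
    generalize F 2 = x2 at *
    generalize F 3 = x3 at *
    generalize F 4 = x4 at *
    generalize F 5 = x5 at *
    generalize F 6 = x6 at *
    have key : ∀ x0 x1 : Fin 4, x0 ≠ x1 → ∀ x2, x1 ≠ x2 → x0 ≠ x2 → ∀ x3, x2 ≠ x3 → x1 ≠ x3 →
      ∀ x4, x3 ≠ x4 → x2 ≠ x4 → ∀ x5, x4 ≠ x5 → x3 ≠ x5 → x5 ≠ x0 → ∀ x6, x5 ≠ x6 → x4 ≠ x6 →
      x6 ≠ x0 → x6 ≠ x1 →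
      ((x1 = x4 ∧ x2 = x5 ∧ x3 = x6) ∨ (x2 = x5 ∧ x3 = x6 ∧ x4 = x0) ∨
      (x3 = x6 ∧ x4 = x0 ∧ x5 = x1) ∨ (x4 = x0 ∧ x5 = x1 ∧ x6 = x2) ∨
      (x5 = x1 ∧ x6 = x2 ∧ x0 = x3) ∨ (x6 = x2 ∧ x0 = x3 ∧ x1 = x4) ∨
      (x0 = x3 ∧ x1 = x4 ∧ x2 = x5)) := by
      set_option maxRecDepth 100000 in decide
    exact key x0 x1 n1 x2 n2 m1 x3 n3 m2 x4 n4 m3 x5 n5 m4 m6 x6 n6 m5 n7 m7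
  rcases h with ⟨a, b, d⟩ | ⟨a, b, d⟩ | ⟨a, b, d⟩ | ⟨a, b, d⟩ | ⟨a, b, d⟩ | ⟨a, b, d⟩ | ⟨a, b, d⟩
  · exact D.not7 a b d
  · exact (D.shift 1).not7 a b (by simpa [e7] using d)
  · exact (D.shift 2).not7 a (by simpa [e7] using b) (by simpa [e8] using d)
  · exact (D.shift 3).not7 (by simpa [e7] using a) (by simpa [e8] using b) (by simpa [e9] using d)
  · exact (D.shift 4).not7 (by simpa [e8] using a) (by simpa [e9] using b)
      (by simpa [e7, e10] using d)
  · exact (D.shift 5).not7 (by simpa [e9] using a) (by simpa [e7, e10] using b)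
      (by simpa [e8, e11] using d)
  · exact (D.shift 6).not7 (by simpa [e7, e10] using a) (by simpa [e8, e11] using b)
      (by simpa [e9, e12] using d)

end NCData

/-- Cyclic enumeration of a finite subset of the circle. -/
lemma nc_enum (E : Set (AddCircle (1:ℝ))) (hE : E.Finite) (n : ℕ) (hn : E.ncard = n)
    (hn0 : 0 < n) : ∃ T : ℕ → ℝ, StrictMono T ∧ (∀ k, T (k + n) = T k + 1) ∧
      (∀ k, (T k : AddCircle (1:ℝ)) ∈ E) ∧
      ∀ k t, T k < t → t < T (k + 1) → (t : AddCircle (1:ℝ)) ∉ E := by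
  classical
  let g : AddCircle (1:ℝ) → ℝ := fun x => (AddCircle.equivIco (1:ℝ) 0 x : ℝ)
  have hginj : Function.Injective g :=
    Subtype.val_injective.comp (AddCircle.equivIco (1:ℝ) 0).injective
  have hgc : ∀ x, (g x : AddCircle (1:ℝ)) = x := fun x => AddCircle.coe_equivIco
  have hgm : ∀ x, 0 ≤ g x ∧ g x < 1 := fun x => by
    have := (AddCircle.equivIco (1:ℝ) 0 x).2
    simpa using this
  have hgr : ∀ t : ℝ, 0 ≤ t → t < 1 → g (t : AddCircle (1:ℝ)) = t := fun t h0 h1 =>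
    AddCircle.equivIco_coe_of_mem (by simpa using ⟨h0, h1⟩)
  let S : Finset ℝ := hE.toFinset.image g
  have hS : S.card = n := by
    rw [Finset.card_image_of_injective _ hginj, ← hn, Set.ncard_eq_toFinset_card _ hE]
  have hSm : ∀ t : ℝ, 0 ≤ t → t < 1 → (t : AddCircle (1:ℝ)) ∈ E → t ∈ S := fun t h0 h1 h =>
    Finset.mem_image.2 ⟨t, by simpa using h, hgr t h0 h1⟩
  have hS1 : ∀ t ∈ S, 0 ≤ t ∧ t < 1 ∧ (t : AddCircle (1:ℝ)) ∈ E := fun t ht => by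
    obtain ⟨x, hx, rfl⟩ := Finset.mem_image.1 ht
    refine ⟨(hgm x).1, (hgm x).2, ?_⟩
    rw [hgc]
    simpa using hx
  let e := S.orderEmbOfFin hS
  have he : ∀ m, e m ∈ S := fun m => Finset.orderEmbOfFin_mem S hS m
  have hes : ∀ t ∈ S, ∃ m, e m = t := fun t ht => by
    have : t ∈ Set.range (S.orderEmbOfFin hS) := by
      rw [Finset.range_orderEmbOfFin]; exact ht
    exact this
  have hshift : ∀ (t : ℝ) (q : ℕ), ((t - q : ℝ) : AddCircle (1:ℝ)) = t := fun t q => by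
    have : ((q : ℝ) : AddCircle (1:ℝ)) = 0 := by
      rw [AddCircle.coe_eq_zero_iff]
      exact ⟨q, by simp⟩
    rw [AddCircle.coe_sub, this, sub_zero]
  let T : ℕ → ℝ := fun k => e ⟨k % n, Nat.mod_lt _ hn0⟩ + (k / n : ℕ)
  have hT : ∀ k, T k = e ⟨k % n, Nat.mod_lt _ hn0⟩ + (k / n : ℕ) := fun k => rfl
  -- the successor step
  have hstep : ∀ k, T k < T (k + 1) ∧
      ∀ t, T k < t → t < T (k + 1) → (t : AddCircle (1:ℝ)) ∉ E := by
    intro k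
    have hp := Nat.mod_lt k hn0
    have hdm := Nat.div_add_mod k n
    rcases Nat.lt_or_ge (k % n + 1) n with h | h
    · have h1 : (k + 1) % n = k % n + 1 := by
        rw [Nat.add_mod, Nat.mod_eq_of_lt (show 1 < n by omega), Nat.mod_eq_of_lt h]
      have h2 : (k + 1) / n = k / n := by
        rw [Nat.div_eq_iff hn0]
        rw [mul_comm] at hdm
        constructor <;> omega
      have hT1 : T (k + 1) = e ⟨k % n + 1, h⟩ + (k / n : ℕ) := by
        rw [hT, h2]; congr 3
      rw [hT1, hT]
      constructor
      · have : e ⟨k % n, hp⟩ < e ⟨k % n + 1, h⟩ := e.strictMono (by simp [Fin.lt_def])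
        linarith
      · intro t ht1 ht2 htE
        rw [← hshift t (k / n)] at htE
        have b1 := hS1 _ (he ⟨k % n, hp⟩)
        have b2 := hS1 _ (he ⟨k % n + 1, h⟩)
        obtain ⟨m, hm⟩ := hes _ (hSm _ (by linarith [b1.1]) (by linarith [b2.2.1]) htE)
        have c1 : e ⟨k % n, hp⟩ < e m := by rw [hm]; linarith
        have c2 : e m < e ⟨k % n + 1, h⟩ := by rw [hm]; linarith
        rw [e.lt_iff_lt, Fin.lt_def] at c1 c2
        simp only at c1 c2
        omega
    · have hpe : k % n + 1 = n := by omega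
      have h3 : k + 1 = n * (k / n + 1) := by rw [mul_add]; omega
      have h1 : (k + 1) % n = 0 := by rw [h3]; simp
      have h2 : (k + 1) / n = k / n + 1 := by
        rw [h3, Nat.mul_div_cancel_left _ hn0]
      have hT1 : T (k + 1) = e ⟨0, hn0⟩ + (k / n : ℕ) + 1 := by
        rw [hT, h2]; push_cast; rw [← add_assoc]; congr 4
      rw [hT1, hT]
      have b1 := hS1 _ (he ⟨k % n, hp⟩)
      have b2 := hS1 _ (he ⟨0, hn0⟩)
      constructor
      · linarith [b1.2.1, b2.1]
      · intro t ht1 ht2 htE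
        rcases lt_or_ge (t - (k / n : ℕ)) 1 with hlt | hge
        · rw [← hshift t (k / n)] at htE
          obtain ⟨m, hm⟩ := hes _ (hSm _ (by linarith [b1.1]) hlt htE)
          have c1 : e ⟨k % n, hp⟩ < e m := by rw [hm]; linarith
          rw [e.lt_iff_lt, Fin.lt_def] at c1
          have := m.2
          simp only at c1
          omega
        · rw [← hshift t (k / n + 1)] at htE
          push_cast at htE
          obtain ⟨m, hm⟩ := hes _ (hSm _ (by linarith) (by linarith [b2.2.1]) htE)
          have c1 : e m < e ⟨0, hn0⟩ := by rw [hm]; linarith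
          rw [e.lt_iff_lt, Fin.lt_def] at c1
          simp only at c1
          omega
  refine ⟨T, strictMono_nat_of_lt_succ fun k => (hstep k).1, ?_, ?_, fun k => (hstep k).2⟩
  · intro k
    have h2 : (k + n) / n = k / n + 1 := Nat.add_div_right k hn0
    rw [hT, hT, h2]
    push_cast
    rw [← add_assoc]
    congr 4
    simp
  · intro k
    have := (hS1 _ (he ⟨k % n, Nat.mod_lt _ hn0⟩)).2.2
    rw [← hshift (T k) (k / n), hT]
    simpa using this

/-- On a connected set of parameters without edge points the curve stays in one face. -/
lemma nc_face (c : ℝ → Fin 4 → ℝ) (hc : Continuous c) (hb : ∀ t, ∃ i, c t i = 0)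
    (S : Set ℝ) (hS : IsPreconnected S) (x : ℝ) (hx : x ∈ S)
    (hE : ∀ t ∈ S, ∀ i j, c t i = 0 → c t j = 0 → i = j) :
    ∃ i, ∀ t ∈ S, c t i = 0 := by
  have hcc : ∀ m, IsClosed {t | c t m = 0} := fun m =>
    isClosed_eq ((continuous_apply m).comp hc) continuous_const
  obtain ⟨i, hi⟩ := hb x
  refine ⟨i, fun t ht => ?_⟩
  by_contra hne
  obtain ⟨j, hj⟩ := hb t
  have hcl : IsClosed (⋃ m ∈ {m : Fin 4 | m ≠ i}, {t | c t m = 0}) :=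
    (Set.toFinite _).isClosed_biUnion fun m _ => hcc m
  obtain ⟨s, hs, hs1, hs2⟩ := isPreconnected_closed_iff.1 hS _ _ (hcc i) hcl
    (fun s _ => by
      obtain ⟨m, hm⟩ := hb s
      by_cases h : m = i
      · left; subst h; exact hm
      · right; exact mem_biUnion h hm)
    ⟨x, hx, hi⟩ ⟨t, ht, mem_biUnion (show j ≠ i from fun h => hne (h ▸ hj)) hj⟩
  simp only [mem_iUnion] at hs2
  obtain ⟨m, hm, hs2⟩ := hs2
  exact hm (hE s hs m i hs2 hs1)

/-- No component of the curve in a face has both endpoints on one edge. -/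
lemma nc_comp (γ : AddCircle (1 : ℝ) → Fin 4 → ℝ)
    (harc : ∀ i j : Fin 4, i ≠ j → ∀ t, γ t i = 0 →
      ¬ (frontier (connectedComponentIn {s | γ s i = 0} t) ⊆ {s | γ s j = 0}))
    (i j : Fin 4) (hij : i ≠ j) (a' a b b' : ℝ) (h1 : a' < a) (h2 : a ≤ b) (h3 : b < b')
    (hin : ∀ s : ℝ, a ≤ s → s ≤ b → γ s i = 0)
    (hout : ∀ s : ℝ, a' < s → s < b' → γ s i = 0 → a ≤ s ∧ s ≤ b)
    (ha : γ a j = 0) (hb : γ b j = 0) : False := by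
  have hq : Continuous ((↑) : ℝ → AddCircle (1:ℝ)) := AddCircle.continuous_mk' 1
  have ho : IsOpenMap ((↑) : ℝ → AddCircle (1:ℝ)) := QuotientAddGroup.isOpenMap_coe
  apply harc i j hij a (hin a le_rfl h2)
  set C := connectedComponentIn {s | γ s i = 0} (a : AddCircle (1:ℝ)) with hC
  set K : Set (AddCircle (1:ℝ)) := ((↑) : ℝ → AddCircle (1:ℝ)) '' Icc a b with hK
  have haK : (a : AddCircle (1:ℝ)) ∈ K := ⟨a, ⟨le_rfl, h2⟩, rfl⟩
  have hKcl : IsClosed K := (isCompact_Icc.image hq).isClosed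
  have haC : (a : AddCircle (1:ℝ)) ∈ C := mem_connectedComponentIn (hin a le_rfl h2)
  have hCK : C ⊆ K := by
    intro x hx
    by_contra hxK
    obtain ⟨y, hyC, ⟨s, hs, rfl⟩, hyK⟩ := isPreconnected_connectedComponentIn
      (((↑) : ℝ → AddCircle (1:ℝ)) '' Ioo a' b') Kᶜ (ho _ isOpen_Ioo) hKcl.isOpen_compl
      (fun y _ => by
        by_cases hy : y ∈ K
        · left
          obtain ⟨s, hs, rfl⟩ := hy
          exact ⟨s, ⟨by linarith [hs.1], by linarith [hs.2]⟩, rfl⟩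
        · right; exact hy)
      ⟨a, haC, a, ⟨h1, by linarith⟩, rfl⟩ ⟨x, hx, hxK⟩
    have := connectedComponentIn_subset _ _ hyC
    exact hyK ⟨s, hout s hs.1 hs.2 this, rfl⟩
  have hKC : K ⊆ C := by
    apply IsPreconnected.subset_connectedComponentIn (isPreconnected_Icc.image _ hq.continuousOn) haK
    rintro _ ⟨s, hs, rfl⟩
    exact hin s hs.1 hs.2
  have hCe : C = K := hCK.antisymm hKC
  rw [hCe]
  rintro x ⟨hx1, hx2⟩
  rw [hKcl.closure_eq] at hx1
  obtain ⟨s, hs, rfl⟩ := hx1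
  rcases hs.1.eq_or_lt with h | h
  · rw [← h]; exact ha
  rcases hs.2.eq_or_lt with h' | h'
  · rw [h']; exact hb
  exfalso
  apply hx2
  exact interior_maximal (image_mono Ioo_subset_Icc_self) (ho _ isOpen_Ioo) ⟨s, ⟨h, h'⟩, rfl⟩

lemma nc_data (γ : AddCircle (1 : ℝ) → Fin 4 → ℝ)
    (hcont : Continuous γ) (hinj : Function.Injective γ)
    (hmem : ∀ t, γ t ∈ stdSimplex ℝ (Fin 4))
    (hbdry : ∀ t, ∃ i, γ t i = 0)
    (hfin : {t | ∃ i j, i ≠ j ∧ γ t i = 0 ∧ γ t j = 0}.Finite)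
    (harc : ∀ i j : Fin 4, i ≠ j → ∀ t, γ t i = 0 →
      ¬ (frontier (connectedComponentIn {s | γ s i = 0} t) ⊆ {s | γ s j = 0}))
    (n : ℕ) (hn : {t | ∃ i j, i ≠ j ∧ γ t i = 0 ∧ γ t j = 0}.ncard = n) (hn0 : 0 < n) :
    ∃ (c : ℝ → Fin 4 → ℝ) (T : ℕ → ℝ) (F : ℕ → Fin 4), NCData n c T F := by
  obtain ⟨T, hmono, hper, hTE, hgap⟩ := nc_enum _ hfin n hn hn0
  have hq : Continuous ((↑) : ℝ → AddCircle (1:ℝ)) := AddCircle.continuous_mk' 1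
  let c : ℝ → Fin 4 → ℝ := fun t => γ t
  have hc : Continuous c := hcont.comp hq
  have hcper : ∀ t, c (t + 1) = c t := fun t => by
    simp only [c]
    congr 1
    exact AddCircle.coe_add_period 1 t
  have hlt : ∀ k, T k < T (k + 1) := fun k => hmono (Nat.lt_succ_self k)
  have huniq : ∀ k, ∀ t ∈ Ioo (T k) (T (k + 1)), ∀ i j, c t i = 0 → c t j = 0 → i = j := by
    intro k t ht i j hi hj
    by_contra hne
    exact hgap k t ht.1 ht.2 ⟨i, j, hne, hi, hj⟩
  have hex : ∀ k, ∃ i, ∀ t ∈ Ioo (T k) (T (k + 1)), c t i = 0 := fun k =>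
    nc_face c hc (fun t => hbdry t) _ isPreconnected_Ioo ((T k + T (k + 1)) / 2)
      ⟨by linarith [hlt k], by linarith [hlt k]⟩ (huniq k)
  choose F hF using hex
  have hface : ∀ k, ∀ t ∈ Icc (T k) (T (k + 1)), c t (F k) = 0 := by
    intro k
    have hcl : IsClosed {t | c t (F k) = 0} :=
      isClosed_eq ((continuous_apply (F k)).comp hc) continuous_const
    have := closure_minimal (fun t ht => hF k t ht : Ioo (T k) (T (k + 1)) ⊆ _) hcl
    rw [closure_Ioo (hlt k).ne] at this
    exact fun t ht => this ht
  have hne1 : ∀ k, F k ≠ F (k + 1) := by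
    intro k heq
    have hp : c (T (k + 1)) (F k) = 0 := hface k _ ⟨(hlt k).le, le_rfl⟩
    obtain ⟨j, hj, hjz⟩ : ∃ j, j ≠ F k ∧ c (T (k + 1)) j = 0 := by
      obtain ⟨i, j, hij, hi, hj⟩ := hTE (k + 1)
      by_cases h : i = F k
      · exact ⟨j, fun h' => hij (h.trans h'.symm), hj⟩
      · exact ⟨i, h, hi⟩
    refine nc_comp γ harc j (F k) hj (T k) (T (k + 1)) (T (k + 1)) (T (k + 2)) (hlt k) le_rfl
      (hlt (k + 1)) (fun s h1 h2 => ?_) (fun s h1 h2 h3 => ?_) hp hp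
    · rw [le_antisymm h2 h1]; exact hjz
    · rcases lt_trichotomy s (T (k + 1)) with h | h | h
      · exact absurd (huniq k s ⟨h1, h⟩ j (F k) h3 (hF k s ⟨h1, h⟩)) hj
      · exact ⟨h.ge, h.le⟩
      · exact absurd (huniq (k + 1) s ⟨h, h2⟩ j (F k) h3 (heq ▸ hF (k + 1) s ⟨h, h2⟩)) hj
  have hne2 : ∀ k, F k ≠ F (k + 2) := by
    intro k heq
    refine nc_comp γ harc (F (k + 1)) (F k) (hne1 k).symm (T k) (T (k + 1)) (T (k + 2))
      (T (k + 3)) (hlt k) (hlt (k + 1)).le (hlt (k + 2))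
      (fun s h1 h2 => hface (k + 1) s ⟨h1, h2⟩) (fun s h1 h2 h3 => ⟨?_, ?_⟩)
      (hface k _ ⟨(hlt k).le, le_rfl⟩) (heq ▸ hface (k + 2) _ ⟨le_rfl, (hlt (k + 2)).le⟩)
    · by_contra h
      have h := not_le.1 h
      exact hne1 k (huniq k s ⟨h1, h⟩ _ _ (hF k s ⟨h1, h⟩) h3)
    · by_contra h
      have h := not_le.1 h
      exact hne1 (k + 1) (huniq (k + 2) s ⟨h, h2⟩ _ _ h3 (hF (k + 2) s ⟨h, h2⟩))
  refine ⟨c, T, F, ⟨hc, fun t => hmem t, ?_, hmono, hper, ?_, hcper, hface, hne1, hne2⟩⟩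
  · intro s t hst hts he
    have h1 := hinj he
    have h2 : ((t - s : ℝ) : AddCircle (1:ℝ)) = 0 := by rw [AddCircle.coe_sub, h1, sub_self]
    rw [AddCircle.coe_eq_zero_iff] at h2
    obtain ⟨m, hm⟩ := h2
    simp only [zsmul_eq_mul, mul_one] at hm
    have k1 : (0:ℝ) < m := by linarith
    have k2 : (m:ℝ) < 1 := by linarith
    have k1' : 0 < m := by exact_mod_cast k1
    have k2' : m < 1 := by exact_mod_cast k2
    omega
  · intro k
    have hm : (T k + T (k + 1)) / 2 ∈ Ioo (T k) (T (k + 1)) :=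
      ⟨by linarith [hlt k], by linarith [hlt k]⟩
    have hk1 : T (k + n + 1) = T (k + 1) + 1 := by
      rw [← hper (k + 1)]; congr 1; omega
    have hm' : (T k + T (k + 1)) / 2 + 1 ∈ Ioo (T (k + n)) (T (k + n + 1)) := by
      rw [hk1, hper]
      exact ⟨by linarith [hm.1], by linarith [hm.2]⟩
    have e1 := hF _ _ hm'
    rw [hcper] at e1
    exact huniq k _ hm _ _ e1 (hF k _ hm)

/-- A normal curve on the boundary of a tetrahedron has length `3`, `4`, or at least `8`.

The tetrahedron is the standard 3-simplex `stdSimplex ℝ (Fin 4)`; its boundary consists of the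
points with some barycentric coordinate zero, the face opposite to vertex `i` is
`{x | x i = 0}`, the edge shared by faces `i` and `j` is `{x | x i = 0 ∧ x j = 0}`, and the
vertices are the points with some coordinate equal to `1`.  A normal curve is an embedded
closed curve `γ` (a continuous injective map from the circle) in the boundary, missing the
vertices, meeting the edges in finitely many points, such that no component of its
intersection with a face is a closed curve or an arc with both endpoints on one edge
(this is the hypothesis `harc`: the frontier of a component of `γ⁻¹(face i)` is never
contained in a single edge `{x i = 0 ∧ x j = 0}`; in particular no component is the whole
circle, whose frontier is empty).  The length of the curve is the number of its intersection
points with the edges.  Then the length is `3`, `4`, or at least `8`. -/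
theorem normal_curve_length_three_four_or_ge_eight
    (γ : AddCircle (1 : ℝ) → Fin 4 → ℝ)
    (hcont : Continuous γ) (hinj : Function.Injective γ)
    (hmem : ∀ t, γ t ∈ stdSimplex ℝ (Fin 4))
    (hbdry : ∀ t, ∃ i, γ t i = 0)
    (hvert : ∀ t i, γ t i ≠ 1)
    (hfin : {t | ∃ i j, i ≠ j ∧ γ t i = 0 ∧ γ t j = 0}.Finite)
    (harc : ∀ i j : Fin 4, i ≠ j → ∀ t, γ t i = 0 →
      ¬ (frontier (connectedComponentIn {s | γ s i = 0} t) ⊆ {s | γ s j = 0})) :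
    {t | ∃ i j, i ≠ j ∧ γ t i = 0 ∧ γ t j = 0}.ncard = 3 ∨
    {t | ∃ i j, i ≠ j ∧ γ t i = 0 ∧ γ t j = 0}.ncard = 4 ∨
    8 ≤ {t | ∃ i j, i ≠ j ∧ γ t i = 0 ∧ γ t j = 0}.ncard := by
  rcases Nat.lt_or_ge {t | ∃ i j, i ≠ j ∧ γ t i = 0 ∧ γ t j = 0}.ncard 8 with h8 | h8
  swap
  · exact Or.inr (Or.inr h8)
  rcases Nat.eq_zero_or_pos {t | ∃ i j, i ≠ j ∧ γ t i = 0 ∧ γ t j = 0}.ncard with h0 | h0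
  · exfalso
    rw [Set.ncard_eq_zero hfin] at h0
    have hq : Continuous ((↑) : ℝ → AddCircle (1:ℝ)) := AddCircle.continuous_mk' 1
    obtain ⟨i, hi⟩ := nc_face (fun t : ℝ => γ t) (hcont.comp hq) (fun t => hbdry t) univ
      isPreconnected_univ 0 (mem_univ _) (fun t _ i j hi hj => by
        by_contra hne
        have : (t : AddCircle (1:ℝ)) ∈ {t | ∃ i j, i ≠ j ∧ γ t i = 0 ∧ γ t j = 0} :=
          ⟨i, j, hne, hi, hj⟩
        rw [h0] at this
        exact this)
    have hall : {s | γ s i = 0} = univ := by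
      ext s
      obtain ⟨t, rfl⟩ := QuotientAddGroup.mk_surjective s
      simpa using hi t (mem_univ _)
    obtain ⟨j, hj⟩ : ∃ j : Fin 4, i ≠ j := (exists_ne i).imp fun _ h => h.symm
    have hone : γ ((0:ℝ) : AddCircle (1:ℝ)) i = 0 := hi 0 (mem_univ _)
    apply harc i j hj _ hone
    haveI : PreconnectedSpace (AddCircle (1:ℝ)) := inferInstance
    rw [hall, connectedComponentIn_univ, PreconnectedSpace.connectedComponent_eq_univ,
      frontier_univ]
    exact empty_subset _
  · obtain ⟨c, T, F, D⟩ := nc_data γ hcont hinj hmem hbdry hfin harc _ rfl h0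
    generalize {t | ∃ i j, i ≠ j ∧ γ t i = 0 ∧ γ t j = 0}.ncard = n at *
    interval_cases n
    · exact absurd (D.perF 0).symm (D.ne1 0)
    · exact absurd (D.perF 0).symm (D.ne2 0)
    · left; rfl
    · right; left; rfl
    · exact D.not5.elim
    · exact D.not6.elim
    · exact D.not7'.elim
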